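/- Let a > 0 be real. Then ∫₀^∞ x I₀(a x) K₀³(a x) dx = π²/(16a²). -/

import Mathlib

open MeasureTheory Real

noncomputable def besselK (ν x : ℝ) : ℝ :=
  ∫ t in Set.Ioi (0:ℝ), Real.exp (-x * Real.cosh t) * Real.cosh (ν * t)
noncomputable def besselI (ν x : ℝ) : ℝ :=
  ∑' k : ℕ, (1 / ((k.factorial : ℝ) * Real.Gamma ((k : ℝ) + ν + 1))) * (x / 2) ^ (2 * (k : ℝ) + ν)

open Filter Topology Set
open scoped ENNReal

theorem lintegral_eq_two_mul_lintegral_Ioi_of_even {g : ℝ → ℝ≥0∞} (hg : ∀ x, g (-x) = g x) :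
    ∫⁻ x, g x = 2 * ∫⁻ x in Ioi 0, g x := by
  have h1 : ∫⁻ x in Iio 0, g x = ∫⁻ x in Ioi 0, g x := by
    have h := (Measure.measurePreserving_neg (volume : Measure ℝ)).setLIntegral_comp_preimage_emb
      (MeasurableEquiv.neg ℝ).measurableEmbedding g (Ioi 0)
    rw [← h]
    simp [hg]
  rw [← lintegral_add_compl g (measurableSet_Ioi (a := (0 : ℝ))), compl_Ioi,
    setLIntegral_congr Iio_ae_eq_Iic.symm, h1, two_mul]

theorem lintegral_Ioi_of_hasDerivAt_of_nonneg {g g' : ℝ → ℝ} {a l : ℝ}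
    (hd : ∀ x ∈ Ici a, HasDerivAt g (g' x) x) (hp : ∀ x ∈ Ioi a, 0 ≤ g' x)
    (hl : Tendsto g atTop (𝓝 l)) :
    ∫⁻ x in Ioi a, ENNReal.ofReal (g' x) = ENNReal.ofReal (l - g a) := by
  rw [← ofReal_integral_eq_lintegral_ofReal (integrableOn_Ioi_deriv_of_nonneg' hd hp hl),
    integral_Ioi_of_hasDerivAt_of_nonneg' hd hp hl]
  exact (ae_restrict_iff' measurableSet_Ioi).2 (ae_of_all _ hp)

theorem lintegral_pow_mul_exp_neg_mul_Ioi (n : ℕ) {c : ℝ} (hc : 0 < c) :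
    ∫⁻ x in Ioi 0, ENNReal.ofReal (x ^ n * exp (-(c * x)))
      = ENNReal.ofReal (n.factorial / c ^ (n + 1)) := by
  have h := Real.integral_rpow_mul_exp_neg_mul_Ioi (a := n + 1) (by positivity) hc
  have e : ((1 : ℝ) / c) ^ ((n : ℝ) + 1) * Real.Gamma (n + 1) = n.factorial / c ^ (n + 1) := by
    rw [Real.Gamma_nat_eq_factorial]
    norm_cast
    rw [one_div, inv_pow]
    ring
  simp only [add_sub_cancel_right, rpow_natCast] at h
  rw [e] at h
  rw [← h, ofReal_integral_eq_lintegral_ofReal]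
  · apply Integrable.of_integral_ne_zero
    rw [h]
    positivity
  · refine (ae_restrict_iff' measurableSet_Ioi).2 (ae_of_all _ fun x hx => ?_)
    have : (0 : ℝ) < x := hx
    simp only [Pi.zero_apply]
    positivity

theorem tendsto_cosh_atTop : Tendsto cosh atTop atTop := by
  refine tendsto_atTop_mono (fun x => ?_) (tendsto_exp_atTop.atTop_div_const (two_pos (α := ℝ)))
  rw [cosh_eq]
  linarith [exp_pos (-x)]

theorem tendsto_sinh_div_cosh_atTop : Tendsto (fun x => sinh x / cosh x) atTop (𝓝 1) := by
  have h : ∀ x, sinh x / cosh x = 1 - exp (-x) / cosh x := fun x => by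
    have := cosh_pos x
    field_simp
    linarith [cosh_sub_sinh x]
  simp only [h]
  simpa using (tendsto_const_nhds (x := (1 : ℝ))).sub
    ((tendsto_exp_neg_atTop_nhds_zero).div_atTop tendsto_cosh_atTop)

theorem hasDerivAt_sinh_div_cosh_pow (n : ℕ) (x : ℝ) :
    HasDerivAt (fun x => sinh x / cosh x ^ (n + 1))
      ((n + 1) / cosh x ^ (n + 2) - n / cosh x ^ n) x := by
  have hc := cosh_pos x
  refine ((hasDerivAt_sinh x).div ((hasDerivAt_cosh x).fun_pow (n + 1))
    (pow_pos hc _).ne').congr_deriv ?_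
  have hs := sinh_sq x
  push_cast
  field_simp
  rw [hs]
  ring

theorem integral_one_div_cosh_pow (k : ℕ) :
    IntegrableOn (fun t => 1 / cosh t ^ (2 * k + 2)) (Ioi 0) ∧
    ∫ t in Ioi 0, 1 / cosh t ^ (2 * k + 2)
      = 4 ^ k * (k.factorial : ℝ) ^ 2 / (2 * k + 1).factorial := by
  induction k with
  | zero =>
    have hd : ∀ x ∈ Ici (0 : ℝ), HasDerivAt (fun x => sinh x / cosh x) (1 / cosh x ^ 2) x := by
      intro x _
      simpa using hasDerivAt_sinh_div_cosh_pow 0 x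
    have hi := integrableOn_Ioi_deriv_of_nonneg' hd (fun x _ => by positivity)
      tendsto_sinh_div_cosh_atTop
    refine ⟨by simpa using hi, ?_⟩
    simpa using integral_Ioi_of_hasDerivAt_of_tendsto' hd hi tendsto_sinh_div_cosh_atTop
  | succ k ih =>
    obtain ⟨hi, he⟩ := ih
    have hi2 : IntegrableOn (fun t => 1 / cosh t ^ (2 * (k + 1) + 2)) (Ioi 0) := by
      refine Integrable.mono' hi ?_ (ae_of_all _ fun t => ?_)
      · exact (Continuous.div continuous_const (by fun_prop)
          (fun t => (pow_pos (cosh_pos t) _).ne')).aestronglyMeasurable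
      · have hc := cosh_pos t
        rw [norm_of_nonneg (by positivity)]
        exact one_div_le_one_div_of_le (by positivity)
          (pow_le_pow_right₀ (one_le_cosh t) (by omega))
    refine ⟨hi2, ?_⟩
    have hl : Tendsto (fun x => sinh x / cosh x ^ (2 * k + 2 + 1)) atTop (𝓝 0) := by
      have h : ∀ x, sinh x / cosh x ^ (2 * k + 2 + 1)
          = sinh x / cosh x / cosh x ^ (2 * k + 2) := fun x => by
        rw [div_div, pow_succ' (cosh x) (2 * k + 2)]
      simp only [h]
      exact tendsto_sinh_div_cosh_atTop.div_atTop
        ((tendsto_pow_atTop (by omega)).comp tendsto_cosh_atTop)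
    have hi2' : IntegrableOn (fun t => ((2 * k + 2 : ℕ) + 1 : ℝ) / cosh t ^ (2 * k + 2 + 2))
        (Ioi 0) := by
      simpa [div_eq_mul_inv, mul_add, IntegrableOn] using hi2.const_mul ((2 * k + 2 : ℕ) + 1 : ℝ)
    have hi' : IntegrableOn (fun t => ((2 * k + 2 : ℕ) : ℝ) / cosh t ^ (2 * k + 2)) (Ioi 0) := by
      simpa [div_eq_mul_inv, IntegrableOn] using hi.const_mul ((2 * k + 2 : ℕ) : ℝ)
    have h := integral_Ioi_of_hasDerivAt_of_tendsto'
      (fun x (_ : x ∈ Ici (0 : ℝ)) => hasDerivAt_sinh_div_cosh_pow (2 * k + 2) x)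
      (hi2'.sub hi') hl
    rw [integral_sub hi2' hi'] at h
    have e1 : ∫ t in Ioi 0, ((2 * k + 2 : ℕ) + 1 : ℝ) / cosh t ^ (2 * k + 2 + 2)
        = (2 * k + 3) * ∫ t in Ioi 0, 1 / cosh t ^ (2 * (k + 1) + 2) := by
      rw [← integral_const_mul]
      congr 1
      ext t
      push_cast
      ring
    have e2 : ∫ t in Ioi 0, ((2 * k + 2 : ℕ) : ℝ) / cosh t ^ (2 * k + 2)
        = (2 * k + 2) * ∫ t in Ioi 0, 1 / cosh t ^ (2 * k + 2) := by
      rw [← integral_const_mul]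
      congr 1
      ext t
      push_cast
      ring
    rw [e1, e2, he] at h
    simp only [sinh_zero, zero_div, sub_zero] at h
    have e3 : (2 * (k + 1) + 1).factorial = (2 * k + 3) * ((2 * k + 2) * (2 * k + 1).factorial) :=
      rfl
    rw [e3, Nat.factorial_succ]
    push_cast
    have hf : ((2 * k + 1).factorial : ℝ) ≠ 0 := by positivity
    rw [sub_eq_zero] at h
    have h3 : (2 * k + 3 : ℝ) ≠ 0 := by positivity
    have h2 : (2 * k + 2 : ℝ) ≠ 0 := by positivity
    apply mul_left_cancel₀ h3
    rw [h]
    field_simp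
    ring

theorem lintegral_one_div_cosh_pow (k : ℕ) :
    ∫⁻ t, ENNReal.ofReal (1 / cosh t ^ (2 * k + 2))
      = ENNReal.ofReal (2 * (4 ^ k * (k.factorial : ℝ) ^ 2 / (2 * k + 1).factorial)) := by
  obtain ⟨hi, he⟩ := integral_one_div_cosh_pow k
  rw [lintegral_eq_two_mul_lintegral_Ioi_of_even (fun x => by rw [cosh_neg]),
    ← ofReal_integral_eq_lintegral_ofReal hi (ae_of_all _ fun t => ?_), he,
    ENNReal.ofReal_mul zero_le_two, ENNReal.ofReal_ofNat]
  have := cosh_pos t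
  simp only [Pi.zero_apply]
  positivity

/-- Twice the modified Bessel function `K₀`, as an extended nonnegative integral over the line. -/
noncomputable def besselKLine (x : ℝ) : ℝ≥0∞ :=
  ∫⁻ t, ENNReal.ofReal (exp (-(x * cosh t)))

@[fun_prop]
theorem measurable_besselKLine : Measurable besselKLine := by
  have : Measurable fun p : ℝ × ℝ => ENNReal.ofReal (exp (-(p.1 * cosh p.2))) := by fun_prop
  exact this.lintegral_prod_right'

theorem lintegral_exp_neg_cosh_add_sinh {A B R : ℝ} (hA : 0 < A) (hR : 0 < R)
    (h : A ^ 2 = R ^ 2 + B ^ 2) :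
    ∫⁻ s, ENNReal.ofReal (exp (-(A * cosh s + B * sinh s))) = besselKLine R := by
  rw [besselKLine, ← lintegral_add_right_eq_self
    (fun s => ENNReal.ofReal (exp (-(R * cosh s)))) (arsinh (B / R))]
  congr 1
  ext s
  have e : √(1 + (B / R) ^ 2) = A / R := by
    rw [show 1 + (B / R) ^ 2 = (A / R) ^ 2 by rw [div_pow, div_pow, h]; field_simp]
    exact sqrt_sq (by positivity)
  rw [cosh_add, cosh_arsinh, sinh_arsinh, e]
  congr 3
  field_simp

theorem besselKLine_mul_besselKLine {α β : ℝ} (hα : 0 < α) (hβ : 0 < β) :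
    besselKLine α * besselKLine β
      = ∫⁻ u, besselKLine √(α ^ 2 + β ^ 2 + 2 * α * β * cosh u) := by
  have h1 : besselKLine α * besselKLine β
      = ∫⁻ s, ∫⁻ u, ENNReal.ofReal (exp (-(α * cosh s + β * cosh (u + s)))) := by
    rw [besselKLine, ← lintegral_mul_const _ (by fun_prop)]
    congr 1
    ext s
    rw [besselKLine, ← lintegral_const_mul _ (by fun_prop), ← lintegral_add_right_eq_self _ s]
    congr 1
    ext u
    rw [← ENNReal.ofReal_mul (exp_pos _).le, ← exp_add]
    congr 2
    ring
  rw [h1, lintegral_lintegral_swap (by unfold Function.uncurry; fun_prop)]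
  congr 1
  ext u
  have hu := cosh_pos u
  rw [← lintegral_exp_neg_cosh_add_sinh (A := α + β * cosh u) (B := β * sinh u)
    (by positivity) (by positivity)]
  · congr 1
    ext s
    rw [cosh_add]
    congr 2
    ring
  · rw [sq_sqrt (by positivity), mul_pow, sinh_sq]
    ring

theorem besselKLine_pow_three {x : ℝ} (hx : 0 < x) :
    besselKLine x ^ 3
      = ∫⁻ u, ∫⁻ v, besselKLine
          (√(1 + 4 * cosh (u / 2) ^ 2 + 4 * cosh (u / 2) * cosh v) * x) := by
  have e : ∀ u, √(x ^ 2 + x ^ 2 + 2 * x * x * cosh u) = 2 * x * cosh (u / 2) := fun u => by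
    have h := cosh_sq (u / 2)
    have h2 := cosh_two_mul (u / 2)
    rw [show 2 * (u / 2) = u by ring] at h2
    have hu := cosh_pos (u / 2)
    rw [← sqrt_sq (show 0 ≤ 2 * x * cosh (u / 2) by positivity), h2]
    congr 1
    linear_combination (2 * x ^ 2) * (-h)
  rw [pow_succ', pow_two, besselKLine_mul_besselKLine hx hx, ← lintegral_const_mul _ (by fun_prop)]
  congr 1
  ext u
  have hu := cosh_pos (u / 2)
  rw [e, besselKLine_mul_besselKLine hx (by positivity)]
  congr 1
  ext v
  congr 1
  have hv := cosh_pos v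
  rw [show x ^ 2 + (2 * x * cosh (u / 2)) ^ 2 + 2 * x * (2 * x * cosh (u / 2)) * cosh v
    = (1 + 4 * cosh (u / 2) ^ 2 + 4 * cosh (u / 2) * cosh v) * x ^ 2 by ring,
    sqrt_mul (by positivity), sqrt_sq hx.le]

theorem lintegral_pow_mul_besselKLine (k : ℕ) {R : ℝ} (hR : 0 < R) :
    ∫⁻ x in Ioi 0, ENNReal.ofReal (x ^ (2 * k + 1)) * besselKLine (R * x)
      = ENNReal.ofReal (2 * (4 ^ k * (k.factorial : ℝ) ^ 2) / R ^ (2 * k + 2)) := by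
  have h1 : ∀ x ∈ Ioi (0 : ℝ), ENNReal.ofReal (x ^ (2 * k + 1)) * besselKLine (R * x)
      = ∫⁻ t, ENNReal.ofReal (x ^ (2 * k + 1) * exp (-(R * cosh t * x))) := fun x hx => by
    have hx : (0 : ℝ) < x := hx
    rw [besselKLine, ← lintegral_const_mul _ (by fun_prop)]
    congr 1
    ext t
    rw [← ENNReal.ofReal_mul (by positivity)]
    congr 4
    ring
  rw [setLIntegral_congr_fun measurableSet_Ioi h1,
    lintegral_lintegral_swap (by unfold Function.uncurry; fun_prop)]
  have h2 : ∀ t, ∫⁻ x in Ioi 0, ENNReal.ofReal (x ^ (2 * k + 1) * exp (-(R * cosh t * x)))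
      = ENNReal.ofReal ((2 * k + 1).factorial / R ^ (2 * k + 2))
        * ENNReal.ofReal (1 / cosh t ^ (2 * k + 2)) := fun t => by
    have ht := cosh_pos t
    rw [lintegral_pow_mul_exp_neg_mul_Ioi _ (by positivity), ← ENNReal.ofReal_mul (by positivity)]
    congr 1
    rw [mul_pow]
    field_simp
  simp only [h2]
  have hm : Measurable fun t => ENNReal.ofReal (1 / cosh t ^ (2 * k + 2)) := by fun_prop
  rw [lintegral_const_mul _ hm, lintegral_one_div_cosh_pow, ← ENNReal.ofReal_mul (by positivity)]
  congr 1
  have : ((2 * k + 1).factorial : ℝ) ≠ 0 := by positivity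
  field_simp

theorem besselI_zero_eq {x : ℝ} (hx : 0 < x) :
    besselI 0 x = ∑' k : ℕ, (x / 2) ^ (2 * k) / (k.factorial : ℝ) ^ 2 := by
  unfold besselI
  congr 1
  ext k
  rw [add_zero, add_zero, Real.Gamma_nat_eq_factorial]
  rw [show 2 * (k : ℝ) = ((2 * k : ℕ) : ℝ) by push_cast; ring, rpow_natCast]
  field_simp

theorem ofReal_mul_besselI_zero {x : ℝ} (hx : 0 < x) :
    ENNReal.ofReal (x * besselI 0 x)
      = ∑' k : ℕ, ENNReal.ofReal (1 / (4 ^ k * (k.factorial : ℝ) ^ 2))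
          * ENNReal.ofReal (x ^ (2 * k + 1)) := by
  have hs : Summable fun k : ℕ => (x / 2) ^ (2 * k) / (k.factorial : ℝ) ^ 2 := by
    refine Summable.of_nonneg_of_le (fun k => by positivity) (fun k => ?_)
      (Real.summable_pow_div_factorial ((x / 2) ^ 2))
    rw [pow_mul]
    refine div_le_div_of_nonneg_left (by positivity) (by positivity) ?_
    exact le_self_pow₀ (by exact_mod_cast Nat.factorial_pos k) two_ne_zero
  rw [besselI_zero_eq hx, ← tsum_mul_left,
    ENNReal.ofReal_tsum_of_nonneg (fun k => by positivity) (hs.mul_left x)]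
  congr 1
  ext k
  rw [← ENNReal.ofReal_mul (by positivity)]
  congr 1
  rw [div_pow, pow_mul (2 : ℝ)]
  norm_num
  field_simp
  ring

@[fun_prop]
theorem measurable_besselI (ν : ℝ) : Measurable (besselI ν) := by
  unfold besselI
  exact Measurable.tsum fun k => by fun_prop

theorem lintegral_mul_besselI_mul_besselKLine {R : ℝ} (hR : 1 < R) :
    ∫⁻ x in Ioi 0, ENNReal.ofReal (x * besselI 0 x) * besselKLine (R * x)
      = ENNReal.ofReal (2 / (R ^ 2 - 1)) := by
  have h0 : 0 < R := by linarith
  have h1 : ∀ x ∈ Ioi (0 : ℝ), ENNReal.ofReal (x * besselI 0 x) * besselKLine (R * x)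
      = ∑' k : ℕ, ENNReal.ofReal (1 / (4 ^ k * (k.factorial : ℝ) ^ 2))
          * (ENNReal.ofReal (x ^ (2 * k + 1)) * besselKLine (R * x)) := fun x hx => by
    rw [ofReal_mul_besselI_zero hx, ← ENNReal.tsum_mul_right]
    simp only [mul_assoc]
  rw [setLIntegral_congr_fun measurableSet_Ioi h1, lintegral_tsum (fun k => by fun_prop)]
  have h2 : ∀ k : ℕ, ∫⁻ x in Ioi 0, ENNReal.ofReal (1 / (4 ^ k * (k.factorial : ℝ) ^ 2))
          * (ENNReal.ofReal (x ^ (2 * k + 1)) * besselKLine (R * x))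
      = ENNReal.ofReal (2 / R ^ 2 * ((R ^ 2)⁻¹) ^ k) := fun k => by
    rw [lintegral_const_mul _ (by fun_prop), lintegral_pow_mul_besselKLine k h0,
      ← ENNReal.ofReal_mul (by positivity)]
    congr 1
    have : (k.factorial : ℝ) ≠ 0 := by positivity
    rw [inv_pow, pow_add, pow_mul]
    field_simp
  simp only [h2]
  have hlt : (R ^ 2)⁻¹ < 1 := inv_lt_one_of_one_lt₀ (one_lt_pow₀ hR two_ne_zero)
  rw [← ENNReal.ofReal_tsum_of_nonneg (fun k => by positivity)
    ((summable_geometric_of_lt_one (by positivity) hlt).mul_left _), tsum_mul_left,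
    tsum_geometric_of_lt_one (by positivity) hlt]
  congr 1
  have : R ^ 2 - 1 ≠ 0 := by nlinarith
  field_simp

theorem tendsto_log_cosh_sub_atTop :
    Tendsto (fun x => log (cosh x) - x) atTop (𝓝 (log (1 / 2))) := by
  have h : ∀ x, log (cosh x) - x = log ((1 + exp (-(2 * x))) / 2) := fun x => by
    rw [show (1 + exp (-(2 * x))) / 2 = cosh x * exp (-x) by
      rw [cosh_eq, div_mul_eq_mul_div, add_mul, ← exp_add, ← exp_add]
      congr 2
      · simp
      · congr 1; ring]
    rw [log_mul (cosh_pos x).ne' (exp_pos _).ne', log_exp]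
    ring
  simp only [h]
  have h2 : Tendsto (fun x : ℝ => exp (-(2 * x))) atTop (𝓝 0) :=
    tendsto_exp_neg_atTop_nhds_zero.comp (tendsto_id.const_mul_atTop two_pos)
  refine Tendsto.log ?_ (by norm_num)
  simpa using (h2.const_add 1).div_const 2

theorem lintegral_one_div_cosh_add_cosh {a : ℝ} (ha : 0 < a) :
    ∫⁻ v, ENNReal.ofReal (1 / (cosh a + cosh v)) = ENNReal.ofReal (2 * a / sinh a) := by
  have hs : 0 < sinh a := sinh_pos_iff.2 ha
  rw [lintegral_eq_two_mul_lintegral_Ioi_of_even (fun x => by rw [cosh_neg])]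
  have hd : ∀ x ∈ Ici (0 : ℝ), HasDerivAt
      (fun v => (log (cosh ((v + a) / 2)) - log (cosh ((v - a) / 2))) / sinh a)
      (1 / (cosh a + cosh x)) x := fun x _ => by
    have c1 := cosh_pos ((x + a) / 2)
    have c2 := cosh_pos ((x - a) / 2)
    have d1 : HasDerivAt (fun v => log (cosh ((v + a) / 2)))
        (sinh ((x + a) / 2) * (1 / 2) / cosh ((x + a) / 2)) x :=
      (((hasDerivAt_id x).add_const a).div_const 2).cosh.log c1.ne'
    have d2 : HasDerivAt (fun v => log (cosh ((v - a) / 2)))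
        (sinh ((x - a) / 2) * (1 / 2) / cosh ((x - a) / 2)) x :=
      (((hasDerivAt_id x).sub_const a).div_const 2).cosh.log c2.ne'
    refine ((d1.sub d2).div_const (sinh a)).congr_deriv ?_
    have e1 : sinh a = sinh ((x + a) / 2) * cosh ((x - a) / 2)
        - cosh ((x + a) / 2) * sinh ((x - a) / 2) := by
      rw [← sinh_sub]
      congr 1
      ring
    have e2 : cosh a + cosh x = 2 * (cosh ((x + a) / 2) * cosh ((x - a) / 2)) := by
      have h1 := cosh_add ((x + a) / 2) ((x - a) / 2)
      have h2 := cosh_sub ((x + a) / 2) ((x - a) / 2)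
      rw [show (x + a) / 2 + (x - a) / 2 = x by ring] at h1
      rw [show (x + a) / 2 - (x - a) / 2 = a by ring] at h2
      linarith
    rw [e2]
    field_simp
    linarith
  have hl : Tendsto (fun v => (log (cosh ((v + a) / 2)) - log (cosh ((v - a) / 2))) / sinh a)
      atTop (𝓝 (a / sinh a)) := by
    refine Tendsto.div_const ?_ _
    have t1 : Tendsto (fun v : ℝ => (v + a) / 2) atTop atTop :=
      (tendsto_atTop_add_const_right _ _ tendsto_id).atTop_div_const two_pos
    have t2 : Tendsto (fun v : ℝ => (v - a) / 2) atTop atTop :=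
      (tendsto_atTop_add_const_right _ (-a) tendsto_id).atTop_div_const two_pos
    have h := ((tendsto_log_cosh_sub_atTop.comp t1).sub
      (tendsto_log_cosh_sub_atTop.comp t2)).add_const a
    simp only [sub_self, zero_add] at h
    refine h.congr fun v => ?_
    simp only [Function.comp_apply]
    ring
  rw [lintegral_Ioi_of_hasDerivAt_of_nonneg hd (fun x _ => ?_) hl]
  · rw [← ENNReal.ofReal_ofNat, ← ENNReal.ofReal_mul zero_le_two]
    congr 1
    rw [show ((0 : ℝ) - a) / 2 = -((0 + a) / 2) by ring, cosh_neg]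
    ring
  · have := cosh_pos x
    have := cosh_pos a
    positivity

theorem hasSum_one_div_odd_sq : HasSum (fun n : ℕ => 1 / (2 * (n : ℝ) + 1) ^ 2) (π ^ 2 / 8) := by
  have h := hasSum_zeta_two
  have he : HasSum (fun n : ℕ => 1 / ((2 * n : ℕ) : ℝ) ^ 2) (π ^ 2 / 24) := by
    have h4 := h.mul_left (1 / 4)
    rw [show 1 / 4 * (π ^ 2 / 6) = π ^ 2 / 24 by ring] at h4
    have e : ∀ n : ℕ, 1 / 4 * (1 / (n : ℝ) ^ 2) = 1 / ((2 * n : ℕ) : ℝ) ^ 2 := fun n => by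
      push_cast
      rw [mul_pow, one_div_mul_one_div]
      norm_num
    simpa only [e] using h4
  have hs : Summable (fun n : ℕ => 1 / ((2 * n + 1 : ℕ) : ℝ) ^ 2) :=
    h.summable.comp_injective (i := fun n : ℕ => 2 * n + 1) (fun a b hab => by simpa using hab)
  have hu := (he.even_add_odd (f := fun n : ℕ => 1 / (n : ℝ) ^ 2) hs.hasSum).unique h
  have : ∑' n : ℕ, 1 / ((2 * n + 1 : ℕ) : ℝ) ^ 2 = π ^ 2 / 8 := by linarith
  rw [← this]
  simpa using hs.hasSum

theorem lintegral_div_sinh :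
    ∫⁻ u in Ioi 0, ENNReal.ofReal (u / sinh u) = ENNReal.ofReal (π ^ 2 / 4) := by
  have h1 : ∀ u ∈ Ioi (0 : ℝ), ENNReal.ofReal (u / sinh u)
      = ∑' n : ℕ, ENNReal.ofReal 2 * ENNReal.ofReal (u ^ 1 * exp (-((2 * n + 1) * u))) := by
    intro u hu
    have hu : (0 : ℝ) < u := hu
    have hlt : exp (-(2 * u)) < 1 := exp_lt_one_iff.2 (by linarith)
    have hg := (hasSum_geometric_of_lt_one (exp_pos _).le hlt).mul_left (2 * (u * exp (-u)))
    have e : ∀ n : ℕ, 2 * (u * exp (-u)) * exp (-(2 * u)) ^ n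
        = 2 * (u ^ 1 * exp (-((2 * n + 1) * u))) := fun n => by
      rw [← exp_nat_mul, pow_one, mul_assoc, mul_assoc, ← exp_add]
      congr 3
      ring
    simp only [e] at hg
    have e2 : u / sinh u = 2 * (u * exp (-u)) * (1 - exp (-(2 * u)))⁻¹ := by
      have hs : 0 < sinh u := sinh_pos_iff.2 hu
      have hne : 1 - exp (-(2 * u)) ≠ 0 := by linarith
      have h3 : 1 - exp (-(2 * u)) = 2 * sinh u * exp (-u) := by
        have h4 : exp u * exp (-u) = 1 := by rw [← exp_add]; simp
        have h5 : exp (-u) * exp (-u) = exp (-(2 * u)) := by rw [← exp_add]; congr 1; ring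
        rw [sinh_eq]
        linear_combination -h4 + h5
      rw [h3]
      field_simp
    rw [e2, ← hg.tsum_eq, ENNReal.ofReal_tsum_of_nonneg (fun n => by positivity) hg.summable]
    congr 1
    ext n
    rw [ENNReal.ofReal_mul zero_le_two]
  rw [setLIntegral_congr_fun measurableSet_Ioi h1, lintegral_tsum (fun k => by fun_prop)]
  have h2 : ∀ n : ℕ, ∫⁻ u in Ioi 0, ENNReal.ofReal 2
        * ENNReal.ofReal (u ^ 1 * exp (-((2 * n + 1) * u)))
      = ENNReal.ofReal (2 * (1 / (2 * (n : ℝ) + 1) ^ 2)) := fun n => by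
    rw [lintegral_const_mul _ (by fun_prop), lintegral_pow_mul_exp_neg_mul_Ioi 1 (by positivity),
      ← ENNReal.ofReal_mul zero_le_two]
    simp
  simp only [h2]
  have hs := hasSum_one_div_odd_sq.mul_left 2
  rw [← ENNReal.ofReal_tsum_of_nonneg (fun n => by positivity) hs.summable, hs.tsum_eq]
  congr 1
  ring

theorem lintegral_mul_besselI_mul_besselKLine_pow_three :
    ∫⁻ x in Ioi 0, ENNReal.ofReal (x * besselI 0 x) * besselKLine x ^ 3
      = ENNReal.ofReal (π ^ 2 / 2) := by
  have hm : Measurable fun q : ℝ × ℝ × ℝ =>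
      ENNReal.ofReal (q.1 * besselI 0 q.1) * besselKLine
        (√(1 + 4 * cosh (q.2.1 / 2) ^ 2 + 4 * cosh (q.2.1 / 2) * cosh q.2.2) * q.1) := by
    fun_prop
  have h1 : ∀ x ∈ Ioi (0 : ℝ), ENNReal.ofReal (x * besselI 0 x) * besselKLine x ^ 3
      = ∫⁻ u, ∫⁻ v, ENNReal.ofReal (x * besselI 0 x) * besselKLine
          (√(1 + 4 * cosh (u / 2) ^ 2 + 4 * cosh (u / 2) * cosh v) * x) := fun x hx => by
    have hm2 : Measurable fun q : ℝ × ℝ => besselKLine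
        (√(1 + 4 * cosh (q.1 / 2) ^ 2 + 4 * cosh (q.1 / 2) * cosh q.2) * x) := by fun_prop
    rw [besselKLine_pow_three hx, ← lintegral_const_mul _ hm2.lintegral_prod_right']
    congr 1
    ext u
    rw [lintegral_const_mul _ (by fun_prop)]
  rw [setLIntegral_congr_fun measurableSet_Ioi h1, lintegral_lintegral_swap]
  swap
  · have : Measurable fun q : (ℝ × ℝ) × ℝ =>
        ENNReal.ofReal (q.1.1 * besselI 0 q.1.1) * besselKLine
          (√(1 + 4 * cosh (q.1.2 / 2) ^ 2 + 4 * cosh (q.1.2 / 2) * cosh q.2) * q.1.1) := by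
      fun_prop
    exact this.lintegral_prod_right'.aemeasurable
  have h2 : ∀ u, ∫⁻ x in Ioi 0, ∫⁻ v, ENNReal.ofReal (x * besselI 0 x) * besselKLine
          (√(1 + 4 * cosh (u / 2) ^ 2 + 4 * cosh (u / 2) * cosh v) * x)
      = ENNReal.ofReal (1 / (2 * cosh (u / 2)))
        * ∫⁻ v, ENNReal.ofReal (1 / (cosh (u / 2) + cosh v)) := fun u => by
    have hu := cosh_pos (u / 2)
    rw [lintegral_lintegral_swap (by unfold Function.uncurry; fun_prop),
      ← lintegral_const_mul _ (by fun_prop)]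
    congr 1
    ext v
    have hv := cosh_pos v
    rw [lintegral_mul_besselI_mul_besselKLine (lt_sqrt_of_sq_lt (by nlinarith [mul_pos hu hv])),
      sq_sqrt (by positivity), ← ENNReal.ofReal_mul (by positivity)]
    congr 1
    rw [show 1 + 4 * cosh (u / 2) ^ 2 + 4 * cosh (u / 2) * cosh v - 1
      = 4 * cosh (u / 2) * (cosh (u / 2) + cosh v) by ring]
    field_simp
    norm_num
  simp only [h2]
  rw [lintegral_eq_two_mul_lintegral_Ioi_of_even (fun u => by rw [neg_div, cosh_neg])]
  have h3 : ∀ u ∈ Ioi (0 : ℝ), ENNReal.ofReal (1 / (2 * cosh (u / 2)))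
        * ∫⁻ v, ENNReal.ofReal (1 / (cosh (u / 2) + cosh v))
      = ENNReal.ofReal (u / sinh u) := fun u hu => by
    have hu : (0 : ℝ) < u := hu
    have hc := cosh_pos (u / 2)
    have hs : 0 < sinh (u / 2) := sinh_pos_iff.2 (half_pos hu)
    rw [lintegral_one_div_cosh_add_cosh (half_pos hu), ← ENNReal.ofReal_mul (by positivity)]
    congr 1
    have h := sinh_two_mul (u / 2)
    rw [show 2 * (u / 2) = u by ring] at h
    rw [h]
    field_simp
  rw [setLIntegral_congr_fun measurableSet_Ioi h3, lintegral_div_sinh, ← ENNReal.ofReal_ofNat,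
    ← ENNReal.ofReal_mul zero_le_two]
  congr 1
  ring

theorem besselK_zero_eq_toReal (x : ℝ) : besselK 0 x = (besselKLine x).toReal / 2 := by
  rw [besselK, integral_eq_lintegral_of_nonneg_ae, besselKLine,
    lintegral_eq_two_mul_lintegral_Ioi_of_even (fun t => by rw [cosh_neg])]
  · simp [neg_mul]
  · exact ae_of_all _ fun t => by simp [exp_nonneg]
  · exact Continuous.aestronglyMeasurable (by fun_prop)

theorem besselKLine_ne_top {x : ℝ} (hx : 0 < x) : besselKLine x ≠ ∞ := by
  rw [besselKLine, lintegral_eq_two_mul_lintegral_Ioi_of_even (fun t => by rw [cosh_neg])]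
  refine ENNReal.mul_ne_top ENNReal.ofNat_ne_top (ne_top_of_le_ne_top ENNReal.ofReal_ne_top
    ((lintegral_mono fun t => ?_).trans_eq (lintegral_pow_mul_exp_neg_mul_Ioi 0 hx)))
  rw [pow_zero, one_mul]
  refine ENNReal.ofReal_le_ofReal (exp_le_exp.2 (neg_le_neg ?_))
  refine mul_le_mul_of_nonneg_left ?_ hx.le
  rcases le_total 0 t with ht | ht
  · exact (self_le_sinh_iff.2 ht).trans (sinh_lt_cosh t).le
  · exact ht.trans (cosh_pos t).le

theorem integral_mul_besselI_mul_besselK_pow_three :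
    ∫ x in Ioi 0, x * besselI 0 x * besselK 0 x ^ 3 = π ^ 2 / 16 := by
  have hI : ∀ x, 0 < x → 0 ≤ besselI 0 x := fun x hx => by
    rw [besselI_zero_eq hx]
    exact tsum_nonneg fun k => by positivity
  rw [integral_eq_lintegral_of_nonneg_ae]
  · have h : ∀ x ∈ Ioi (0 : ℝ), ENNReal.ofReal (x * besselI 0 x * besselK 0 x ^ 3)
        = ENNReal.ofReal (1 / 8)
          * (ENNReal.ofReal (x * besselI 0 x) * besselKLine x ^ 3) := fun x hx => by
      have hx : (0 : ℝ) < x := hx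
      have hn := mul_nonneg hx.le (hI x hx)
      rw [← ENNReal.ofReal_toReal (besselKLine_ne_top hx),
        ← ENNReal.ofReal_pow ENNReal.toReal_nonneg, ← ENNReal.ofReal_mul hn,
        ← ENNReal.ofReal_mul (by norm_num), besselK_zero_eq_toReal]
      congr 1
      ring
    rw [setLIntegral_congr_fun measurableSet_Ioi h, lintegral_const_mul _ (by fun_prop),
      lintegral_mul_besselI_mul_besselKLine_pow_three, ← ENNReal.ofReal_mul (by norm_num),
      ENNReal.toReal_ofReal (by positivity)]
    ring
  · refine (ae_restrict_iff' measurableSet_Ioi).2 (ae_of_all _ fun x hx => ?_)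
    have hn := hI x hx
    have hx : (0 : ℝ) < x := hx
    simp only [Pi.zero_apply, besselK_zero_eq_toReal]
    positivity
  · simp only [besselK_zero_eq_toReal]
    exact Measurable.aestronglyMeasurable (by fun_prop)

theorem stmt13 (a : ℝ) (ha : 0 < a) :
    (∫ x in Set.Ioi (0:ℝ), x * besselI 0 (a * x) * (besselK 0 (a * x)) ^ 3)
    = π ^ 2 / (16 * a ^ 2) := by
  have h := integral_comp_mul_left_Ioi
    (fun y => a⁻¹ * (y * besselI 0 y * besselK 0 y ^ 3)) 0 ha
  have e : ∀ x, a⁻¹ * (a * x * besselI 0 (a * x) * besselK 0 (a * x) ^ 3)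
      = x * besselI 0 (a * x) * besselK 0 (a * x) ^ 3 := fun x => by
    field_simp
  simp only [e, mul_zero] at h
  rw [h, integral_const_mul, integral_mul_besselI_mul_besselK_pow_three, smul_eq_mul]
  field_simp
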